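/- arXiv:1102.3621 — 4 statements merged into one kernel-verified Lean document; each statement's English description precedes it below -/
import Mathlib

section
/- Let μ_1, …, μ_{N+1} be probability measures on ℝ with dμ_i(t) = e^{ψ_i(t)}dt, ψ_i ∈ C²(ℝ), and let μ = μ_1 × ⋯ × μ_{N+1} be their product on ℝ^{N+1}, whose density is e^{φ(x)} with φ(x) = ψ_1(x_1)+⋯+ψ_{N+1}(x_{N+1}). For a unit vector v ∈ S^N and t ∈ ℝ, the half-space H^{N+1}_{v,t} = {x ∈ ℝ^{N+1} : ⟨x,v⟩ < t} is stationary for μ if and only if at least one of the following holds: (i) H^{N+1}_{v,t} is a coordinate half-space (v has exactly one non-zero component); (ii) v has exactly two non-zero components v_i, v_j and ψ_i''(x) = ψ_j''(τ − αx) for every x ∈ ℝ, where τ = t/v_j and α = v_i/v_j; (iii) v has at least three non-zero components and for every pair of indices i, k with v_i ≠ 0 and v_k ≠ 0 the second derivatives ψ_i'' and ψ_k'' are equal to one and the same constant (i.e., the corresponding measures μ_i are Gaussian with the same variance). -/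
open MeasureTheory Real

theorem hasDerivAt_deriv_of_contDiff_two {f : ℝ → ℝ} (hf : ContDiff ℝ 2 f) (x : ℝ) :
    HasDerivAt (deriv f) (deriv (deriv f) x) x :=
  (((contDiff_succ_iff_deriv (n := 1)).1 hf).2.2.differentiable one_ne_zero x).hasDerivAt

/-- If a weighted sum of first derivatives is constant on a hyperplane, then differentiating along
`v j • e i - v i • e j` shows that the second derivatives agree at each of its points. -/
theorem deriv_deriv_eq_of_const_on_hyperplane {ι : Type*} [Fintype ι] [DecidableEq ι]
    {ψ : ι → ℝ → ℝ} (hψ : ∀ i, ContDiff ℝ 2 (ψ i)) {v : ι → ℝ} {t c : ℝ}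
    (h : ∀ x : ι → ℝ, (∑ i, x i * v i) = t → -(∑ i, deriv (ψ i) (x i) * v i) = c)
    {i j : ι} (hi : v i ≠ 0) (hj : v j ≠ 0) {x : ι → ℝ} (hx : (∑ i, x i * v i) = t) :
    deriv (deriv (ψ i)) (x i) = deriv (deriv (ψ j)) (x j) := by
  set w : ι → ℝ := Pi.single i (v j) - Pi.single j (v i) with hw
  have hwv : ∀ a : ι → ℝ, ∑ k, a k * w k * v k = (a i - a j) * (v i * v j) := by
    intro a
    simp only [hw, Pi.sub_apply, mul_sub, sub_mul, Finset.sum_sub_distrib, Pi.single_apply,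
      mul_ite, ite_mul, mul_zero, zero_mul, Finset.sum_ite_eq', Finset.mem_univ, if_true]
    ring
  have hline : ∀ s : ℝ, ∑ k, deriv (ψ k) (x k + s * w k) * v k = -c := by
    intro s
    have h0 : ∑ k, s * w k * v k = 0 := by simpa using hwv fun _ => s
    rw [← h (fun k => x k + s * w k), neg_neg]
    simp only [add_mul, Finset.sum_add_distrib, hx, h0, add_zero]
  have hd : HasDerivAt (fun s : ℝ => ∑ k, deriv (ψ k) (x k + s * w k) * v k)
      (∑ k, deriv (deriv (ψ k)) (x k) * w k * v k) 0 := by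
    refine HasDerivAt.fun_sum fun k _ => HasDerivAt.mul_const ?_ _
    have h1 : HasDerivAt (fun s : ℝ => x k + s * w k) (w k) 0 := by
      simpa using ((hasDerivAt_id (0 : ℝ)).mul_const (w k)).const_add (x k)
    have h2 := (hasDerivAt_deriv_of_contDiff_two (hψ k) (x k + 0 * w k)).comp (0 : ℝ) h1
    rwa [zero_mul, add_zero] at h2
  have h0 := hd.unique (by simpa only [hline] using hasDerivAt_const (0 : ℝ) (-c))
  rw [hwv fun k => deriv (deriv (ψ k)) (x k)] at h0
  exact sub_eq_zero.1 ((mul_eq_zero.1 h0).resolve_right (mul_ne_zero hi hj))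

/-- With three nonvanishing weights, two of the second derivatives agree at arbitrary points. -/
theorem deriv_deriv_eq_of_three_ne_zero {ι : Type*} [Fintype ι] [DecidableEq ι]
    {ψ : ι → ℝ → ℝ} (hψ : ∀ i, ContDiff ℝ 2 (ψ i)) {v : ι → ℝ} {t c : ℝ}
    (h : ∀ x : ι → ℝ, (∑ i, x i * v i) = t → -(∑ i, deriv (ψ i) (x i) * v i) = c)
    {i j k : ι} (hij : i ≠ j) (hik : i ≠ k) (hjk : j ≠ k)
    (hi : v i ≠ 0) (hj : v j ≠ 0) (hk : v k ≠ 0) (p q : ℝ) :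
    deriv (deriv (ψ i)) p = deriv (deriv (ψ j)) q := by
  have hx : ∑ l, (Pi.single i p + Pi.single j q +
      Pi.single k ((t - p * v i - q * v j) / v k) : ι → ℝ) l * v l = t := by
    simp only [Pi.add_apply, add_mul, Finset.sum_add_distrib, Pi.single_apply, ite_mul, zero_mul,
      Finset.sum_ite_eq', Finset.mem_univ, if_true]
    field_simp
    ring
  simpa [hij, hij.symm, hik, hjk] using deriv_deriv_eq_of_const_on_hyperplane hψ h hi hj hx

/-- Characterization of stationary half-spaces `H = {x : ⟨x,v⟩ < t}` for a product
`μ = μ₁ × ⋯ × μ_{N+1}` of probability measures `dμᵢ = e^{ψᵢ} dt` on `ℝ`.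
The half-space is stationary (i.e. the generalized mean curvature
`-⟨Dφ(x), v⟩ = -∑ᵢ ψᵢ'(xᵢ) vᵢ` is constant on the boundary hyperplane `{⟨x,v⟩ = t}`)
if and only if (i) `H` is a coordinate half-space, or (ii) `v` has exactly two
non-zero components `vᵢ, vⱼ` and `ψᵢ''(x) = ψⱼ''(τ - αx)` with `τ = t/vⱼ`, `α = vᵢ/vⱼ`,
or (iii) `v` has at least three non-zero components and all the `ψₖ''` with `vₖ ≠ 0`
are equal to one and the same constant. -/
theorem stationary_halfspace_product_characterization
    (N : ℕ) (ψ : Fin (N + 1) → ℝ → ℝ)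
    (hψ : ∀ i, ContDiff ℝ 2 (ψ i))
    (hprob : ∀ i, (∫ x : ℝ, Real.exp (ψ i x)) = 1)
    (v : Fin (N + 1) → ℝ) (hv : ∑ i, v i ^ 2 = 1) (t : ℝ) :
    (∃ c : ℝ, ∀ x : Fin (N + 1) → ℝ, (∑ i, x i * v i) = t →
        -(∑ i, deriv (ψ i) (x i) * v i) = c)
    ↔ ((∃ i, v i ≠ 0 ∧ ∀ j, j ≠ i → v j = 0)
      ∨ (∃ i j, i ≠ j ∧ v i ≠ 0 ∧ v j ≠ 0 ∧ (∀ k, k ≠ i → k ≠ j → v k = 0) ∧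
          ∀ x : ℝ, deriv (deriv (ψ i)) x = deriv (deriv (ψ j)) (t / v j - v i / v j * x))
      ∨ ((∃ i j k, i ≠ j ∧ i ≠ k ∧ j ≠ k ∧ v i ≠ 0 ∧ v j ≠ 0 ∧ v k ≠ 0) ∧
          ∃ c : ℝ, ∀ i, v i ≠ 0 → ∀ x : ℝ, deriv (deriv (ψ i)) x = c)) := by
  constructor
  · rintro ⟨c, h⟩
    obtain ⟨i, hi⟩ : ∃ i, v i ≠ 0 := by
      by_contra! h0
      simp [h0] at hv
    by_cases h1 : ∀ j, j ≠ i → v j = 0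
    · exact Or.inl ⟨i, hi, h1⟩
    push Not at h1
    obtain ⟨j, hji, hj⟩ := h1
    by_cases h2 : ∀ k, k ≠ i → k ≠ j → v k = 0
    · refine Or.inr (Or.inl ⟨i, j, hji.symm, hi, hj, h2, fun x => ?_⟩)
      have hx : ∑ l, (Pi.single i x + Pi.single j (t / v j - v i / v j * x) :
          Fin (N + 1) → ℝ) l * v l = t := by
        simp only [Pi.add_apply, add_mul, Finset.sum_add_distrib, Pi.single_apply, ite_mul,
          zero_mul, Finset.sum_ite_eq', Finset.mem_univ, if_true]
        field_simp
        ring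
      simpa [hji, hji.symm] using deriv_deriv_eq_of_const_on_hyperplane hψ h hi hj hx
    push Not at h2
    obtain ⟨k, hki, hkj, hk⟩ := h2
    refine Or.inr (Or.inr ⟨⟨i, j, k, hji.symm, hki.symm, hkj.symm, hi, hj, hk⟩,
      deriv (deriv (ψ i)) 0, fun l hl x => ?_⟩)
    by_cases hli : l = i
    · subst hli
      exact (deriv_deriv_eq_of_three_ne_zero hψ h hji.symm hki.symm hkj.symm hi hj hk x 0).trans
        (deriv_deriv_eq_of_three_ne_zero hψ h hji.symm hki.symm hkj.symm hi hj hk 0 0).symm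
    by_cases hlj : l = j
    · subst hlj
      exact deriv_deriv_eq_of_three_ne_zero hψ h hli hkj.symm hki.symm hl hi hk x 0
    · exact deriv_deriv_eq_of_three_ne_zero hψ h hli hlj hji.symm hl hi hj x 0
  · rintro (⟨i, hi, h0⟩ | ⟨i, j, hij, hi, hj, h0, h⟩ | ⟨-, c, h⟩)
    · refine ⟨-(deriv (ψ i) (t / v i) * v i), fun x hx => ?_⟩
      rw [Fintype.sum_eq_single i fun k hk => by rw [h0 k hk, mul_zero]] at hx ⊢
      rw [← hx, mul_div_cancel_right₀ _ hi]
    · have hd : ∀ x : ℝ, HasDerivAt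
          (fun x => deriv (ψ i) x * v i + deriv (ψ j) (t / v j - v i / v j * x) * v j) 0 x := by
        intro x
        have h1 : HasDerivAt (fun x : ℝ => t / v j - v i / v j * x) (-(v i / v j)) x := by
          simpa using ((hasDerivAt_id x).const_mul (v i / v j)).const_sub (t / v j)
        have h2 := ((hasDerivAt_deriv_of_contDiff_two (hψ i) x).mul_const (v i)).add
          (((hasDerivAt_deriv_of_contDiff_two (hψ j) _).comp x h1).mul_const (v j))
        refine h2.congr_deriv ?_
        rw [h x]
        field_simp
        ring
      refine ⟨-(deriv (ψ i) 0 * v i + deriv (ψ j) (t / v j - v i / v j * 0) * v j),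
        fun x hx => ?_⟩
      rw [Fintype.sum_eq_add i j hij fun k hk => by rw [h0 k hk.1 hk.2, mul_zero]] at hx ⊢
      have hxj : x j = t / v j - v i / v j * x i := by
        rw [← hx]
        field_simp
        ring
      rw [hxj]
      exact congrArg Neg.neg (is_const_of_deriv_eq_zero (fun y => (hd y).differentiableAt)
        (fun y => (hd y).deriv) (x i) 0)
    · have hlin : ∀ i, v i ≠ 0 → ∀ x, deriv (ψ i) x = c * x + deriv (ψ i) 0 := by
        intro i hi x
        have hd : ∀ y : ℝ, HasDerivAt (fun y => deriv (ψ i) y - c * y) 0 y := by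
          intro y
          have h1 := (hasDerivAt_deriv_of_contDiff_two (hψ i) y).sub
            ((hasDerivAt_id y).const_mul c)
          rwa [h i hi y, mul_one, sub_self] at h1
        have := is_const_of_deriv_eq_zero (fun y => (hd y).differentiableAt)
          (fun y => (hd y).deriv) x 0
        simp only [mul_zero, sub_zero] at this
        linarith
      refine ⟨-(c * t + ∑ i, deriv (ψ i) 0 * v i), fun x hx => ?_⟩
      rw [← hx, Finset.mul_sum, ← Finset.sum_add_distrib]
      congr 1
      refine Finset.sum_congr rfl fun i _ => ?_
      by_cases hi : v i = 0
      · simp [hi]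
      · rw [hlin i hi (x i)]
        ring
end

section
/- Let μ be a probability measure on ℝ with dμ(t) = e^{ψ(t)}dt, ψ ∈ C²(ℝ), and let μ^{N+1} be its (N+1)-fold product measure on ℝ^{N+1}. For a unit vector v ∈ S^N and t ∈ ℝ, the half-space H^{N+1}_{v,t} = {x ∈ ℝ^{N+1} : ⟨x,v⟩ < t} is stationary for μ^{N+1} if and only if at least one of the following holds: (i) H^{N+1}_{v,t} is a coordinate half-space; (ii) v ∈ V_N^- and ψ'' is periodic with period τ = √2·t; (iii) v ∈ V_N^+ and ψ'' is symmetric with respect to the point τ/2 = ±(√2·t)/2 (i.e., ψ''(x) = ψ''(τ − x) for all x); (iv) ψ'' is constant, i.e., μ is a Gaussian measure dμ(x) = (2πσ²)^{−1/2} e^{−x²/(2σ²)} dx. -/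
open MeasureTheory Real

/-- A continuous function invariant under a contracting affine map is constant. -/
theorem Continuous.eq_of_comp_affine_contraction {f : ℝ → ℝ} (hf : Continuous f) {a b : ℝ}
    (ha : |a| < 1) (h : ∀ x, f x = f (a * x + b)) (x : ℝ) : f x = f (b / (1 - a)) := by
  have h1 : 1 - a ≠ 0 := by
    have := (abs_lt.1 ha).2
    linarith
  set p := b / (1 - a) with hp
  have hfix : a * p + b = p := by
    rw [hp]
    field_simp
    ring
  have hiter : ∀ n : ℕ, f (p + a ^ n * (x - p)) = f x := by
    intro n
    induction n with
    | zero => simp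
    | succ n ih =>
      rw [← ih, h (p + a ^ n * (x - p))]
      congr 1
      linear_combination -hfix
  have hlim : Filter.Tendsto (fun n : ℕ => f (p + a ^ n * (x - p))) Filter.atTop (nhds (f p)) := by
    refine (hf.tendsto p).comp ?_
    simpa using ((tendsto_pow_atTop_nhds_zero_of_abs_lt_one ha).mul_const (x - p)).const_add p
  simp only [hiter] at hlim
  exact tendsto_nhds_unique tendsto_const_nhds hlim

/-- A continuous function invariant under an affine map with ratio of absolute value different
from `0` and `1` is constant. -/
theorem Continuous.exists_eq_const_of_comp_affine {f : ℝ → ℝ} (hf : Continuous f) {a b : ℝ}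
    (ha0 : a ≠ 0) (ha : |a| ≠ 1) (h : ∀ x, f x = f (a * x + b)) : ∃ c, ∀ x, f x = c := by
  rcases lt_or_gt_of_ne ha with hlt | hgt
  · exact ⟨_, hf.eq_of_comp_affine_contraction hlt h⟩
  · refine ⟨_, hf.eq_of_comp_affine_contraction (a := a⁻¹) (b := -(a⁻¹ * b)) ?_ fun x => ?_⟩
    · rw [abs_inv]
      exact inv_lt_one_of_one_lt₀ hgt
    · rw [h (a⁻¹ * x + -(a⁻¹ * b))]
      congr 1
      field_simp
      ring

/-- If `∑ g (xᵢ) vᵢ` is constant on the hyperplane `⟨x, v⟩ = t`, then `g'` takes the same value at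
any two coordinates of `x` in the support of `v`. -/
theorem deriv_eq_of_sum_const_on_hyperplane {ι : Type*} [Fintype ι] [DecidableEq ι] {g : ℝ → ℝ}
    (hg : Differentiable ℝ g) {v : ι → ℝ} {t c : ℝ}
    (hc : ∀ x : ι → ℝ, ∑ k, x k * v k = t → -(∑ k, g (x k) * v k) = c)
    {i j : ι} (hi : v i ≠ 0) (hj : v j ≠ 0)
    {x : ι → ℝ} (hx : ∑ k, x k * v k = t) : deriv g (x i) = deriv g (x j) := by
  set w : ι → ℝ := Pi.single i (v j) - Pi.single j (v i) with hw
  have hwv : ∀ u : ι → ℝ, ∑ k, u k * (w k * v k) = u i * (v j * v i) - u j * (v i * v j) := by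
    intro u
    simp [hw, Pi.single_apply, sub_mul, mul_sub, Finset.sum_sub_distrib]
  have hder : HasDerivAt (fun s : ℝ => ∑ k, g (x k + s * w k) * v k)
      (∑ k, deriv g (x k) * (w k * v k)) 0 := by
    refine HasDerivAt.fun_sum fun k _ => ?_
    have h1 : HasDerivAt (fun s : ℝ => x k + s * w k) (w k) 0 := by
      simpa using ((hasDerivAt_id (0 : ℝ)).mul_const (w k)).const_add (x k)
    have h2 : HasDerivAt g (deriv g (x k)) (x k + 0 * w k) := by
      simpa using (hg (x k)).hasDerivAt
    simpa [mul_assoc, Function.comp_def] using (h2.comp 0 h1).mul_const (v k)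
  have hconst : (fun s : ℝ => ∑ k, g (x k + s * w k) * v k) = fun _ => -c := by
    funext s
    rw [← hc (fun k => x k + s * w k), neg_neg]
    have h0 := hwv 1
    simp only [Pi.one_apply, one_mul] at h0
    simp only [add_mul, Finset.sum_add_distrib, hx, mul_assoc, ← Finset.mul_sum, h0]
    ring
  rw [hconst] at hder
  have h0 := hder.unique (hasDerivAt_const _ _)
  rw [hwv fun k => deriv g (x k)] at h0
  have h3 : (deriv g (x i) - deriv g (x j)) * (v i * v j) = 0 := by linear_combination h0
  exact sub_eq_zero.1 ((mul_eq_zero.1 h3).resolve_right (mul_ne_zero hi hj))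

theorem Fintype.sum_eq_add_of_support_subset_pair {ι : Type*} [Fintype ι] {v : ι → ℝ} {i j : ι}
    (hij : i ≠ j) (h0 : ∀ k, k ≠ i → k ≠ j → v k = 0) (u : ι → ℝ) :
    ∑ k, u k * v k = u i * v i + u j * v j :=
  Fintype.sum_eq_add i j hij fun k hk => by rw [h0 k hk.1 hk.2, mul_zero]

/-- Converse of `deriv_eq_of_sum_const_on_hyperplane` when `v` has at most two non-zero
coordinates. -/
theorem exists_sum_const_on_hyperplane_of_pair {ι : Type*} [Fintype ι] {g : ℝ → ℝ}
    (hg : Differentiable ℝ g) {v : ι → ℝ} {t : ℝ} {i j : ι} (hij : i ≠ j)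
    (h0 : ∀ k, k ≠ i → k ≠ j → v k = 0) (hj : v j ≠ 0)
    (h : ∀ x, deriv g x = deriv g ((t - x * v i) / v j)) :
    ∃ c, ∀ x : ι → ℝ, ∑ k, x k * v k = t → -(∑ k, g (x k) * v k) = c := by
  have hder : ∀ x, HasDerivAt (fun x => g x * v i + g ((t - x * v i) / v j) * v j) 0 x := by
    intro x
    have h1 : HasDerivAt (fun x => (t - x * v i) / v j) (-v i / v j) x := by
      simpa using (((hasDerivAt_id x).mul_const (v i)).const_sub t).div_const (v j)
    have h2 := ((hg x).hasDerivAt.mul_const (v i)).add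
      (((hg ((t - x * v i) / v j)).hasDerivAt.comp x h1).mul_const (v j))
    refine h2.congr_deriv ?_
    rw [← h x]
    field_simp
    ring
  refine ⟨-(g 0 * v i + g ((t - 0 * v i) / v j) * v j), fun x hx => ?_⟩
  rw [Fintype.sum_eq_add_of_support_subset_pair hij h0] at hx
  rw [Fintype.sum_eq_add_of_support_subset_pair hij h0 fun k => g (x k)]
  have hxj : x j = (t - x i * v i) / v j := by
    field_simp
    linarith
  rw [hxj, neg_inj]
  exact is_const_of_deriv_eq_zero (fun y => (hder y).differentiableAt) (fun y => (hder y).deriv)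
    (x i) 0

/-- The inverse of a real number of absolute value `1 / √2` is `± √2`. -/
theorem inv_eq_or_eq_neg_sqrt_two {a : ℝ} (ha : |a| = (Real.sqrt 2)⁻¹) :
    a⁻¹ = Real.sqrt 2 ∨ a⁻¹ = -Real.sqrt 2 := by
  refine (abs_eq (Real.sqrt_nonneg 2)).1 ?_
  rw [abs_inv, ha, inv_inv]


/-- Characterization of stationary half-spaces `H = {x : ⟨x,v⟩ < t}` for the
`(N+1)`-fold product `μ^{N+1}` of a probability measure `dμ = e^{ψ} dt` on `ℝ`.
The half-space is stationary (i.e. the generalized mean curvature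
`-∑ᵢ ψ'(xᵢ) vᵢ` is constant on the hyperplane `{⟨x,v⟩ = t}`) if and only if
(i) `H` is a coordinate half-space; or (ii) `v ∈ V_N⁻` (two non-zero coordinates of
absolute value `1/√2` and opposite signs) and `ψ''` is `√2·t`-periodic; or
(iii) `v ∈ V_N⁺` (two non-zero coordinates of absolute value `1/√2` and equal signs)
and `ψ''` is symmetric with respect to `τ/2 = ±(√2 t)/2`, i.e. `ψ''(x) = ψ''(τ - x)`
with `τ = t/vⱼ = ±√2·t`; or (iv) `ψ''` is constant, i.e. `μ` is Gaussian. -/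
theorem stationary_halfspace_power_characterization
    (N : ℕ) (ψ : ℝ → ℝ) (hψ : ContDiff ℝ 2 ψ)
    (hprob : (∫ x : ℝ, Real.exp (ψ x)) = 1)
    (v : Fin (N + 1) → ℝ) (hv : ∑ i, v i ^ 2 = 1) (t : ℝ) :
    (∃ c : ℝ, ∀ x : Fin (N + 1) → ℝ, (∑ i, x i * v i) = t →
        -(∑ i, deriv ψ (x i) * v i) = c)
    ↔ ((∃ i, v i ≠ 0 ∧ ∀ j, j ≠ i → v j = 0)
      ∨ (∃ i j, i ≠ j ∧ (∀ k, k ≠ i → k ≠ j → v k = 0) ∧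
          v i = -v j ∧ |v i| = (Real.sqrt 2)⁻¹ ∧
          Function.Periodic (deriv (deriv ψ)) (Real.sqrt 2 * t))
      ∨ (∃ i j, i ≠ j ∧ (∀ k, k ≠ i → k ≠ j → v k = 0) ∧
          v i = v j ∧ |v i| = (Real.sqrt 2)⁻¹ ∧
          ∀ x : ℝ, deriv (deriv ψ) x = deriv (deriv ψ) (t / v j - x))
      ∨ (∃ c : ℝ, ∀ x : ℝ, deriv (deriv ψ) x = c)) := by
  have hd1 : ContDiff ℝ 1 (deriv ψ) := by
    have h2 : ContDiff ℝ (1 + 1) ψ := by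
      rw [one_add_one_eq_two]
      exact hψ
    exact (contDiff_succ_iff_deriv.1 h2).2.2
  have hg : Differentiable ℝ (deriv ψ) := hd1.differentiable one_ne_zero
  have hcont : Continuous (deriv (deriv ψ)) := hd1.continuous_deriv le_rfl
  constructor
  · rintro ⟨c, hc⟩
    obtain ⟨i, hi⟩ : ∃ i, v i ≠ 0 := by
      by_contra! hall
      simp [hall] at hv
    by_cases hcoord : ∀ j, j ≠ i → v j = 0
    · exact Or.inl ⟨i, hi, hcoord⟩
    push Not at hcoord
    obtain ⟨j, hji, hj⟩ := hcoord
    have hij := hji.symm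
    by_cases h0 : ∀ k, k ≠ i → k ≠ j → v k = 0
    · have hinv : ∀ x, deriv (deriv ψ) x = deriv (deriv ψ) ((t - x * v i) / v j) := by
        intro x
        have hx := deriv_eq_of_sum_const_on_hyperplane hg hc hi hj
          (x := fun k => if k = i then x else (t - x * v i) / v j) (by
            rw [Fintype.sum_eq_add_of_support_subset_pair hij h0]
            simp only [if_true, if_neg hji]
            field_simp
            ring)
        simpa [hji] using hx
      rw [Fintype.sum_eq_add i j hij fun k hk => by simp [h0 k hk.1 hk.2]] at hv
      by_cases habs : |v i| = |v j|
      · have hnorm : |v i| = (Real.sqrt 2)⁻¹ := by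
          have hsq : v i ^ 2 = v j ^ 2 := (sq_eq_sq_iff_abs_eq_abs _ _).2 habs
          rw [← Real.sqrt_inv, ← Real.sqrt_sq_eq_abs]
          congr 1
          linarith
        rcases abs_eq_abs.1 habs with heq | heq
        · refine Or.inr (Or.inr (Or.inl ⟨i, j, hij, h0, heq, hnorm, fun x => ?_⟩))
          rw [hinv x, heq]
          congr 1
          field_simp
        · refine Or.inr (Or.inl ⟨i, j, hij, h0, heq, hnorm, ?_⟩)
          have hper : Function.Periodic (deriv (deriv ψ)) (t * (v j)⁻¹) := by
            intro x
            rw [hinv x, heq]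
            congr 1
            field_simp
            ring
          rcases inv_eq_or_eq_neg_sqrt_two (habs ▸ hnorm) with hs | hs
          · rwa [hs, mul_comm] at hper
          · rw [hs] at hper
            simpa [mul_comm] using hper.neg
      · refine Or.inr (Or.inr (Or.inr (hcont.exists_eq_const_of_comp_affine
          (a := -(v i / v j)) (b := t / v j) (neg_ne_zero.2 (div_ne_zero hi hj)) ?_ fun x => ?_)))
        · rw [abs_neg, abs_div, Ne, div_eq_one_iff_eq (abs_ne_zero.2 hj)]
          exact habs
        · rw [hinv x]
          congr 1
          ring
    · push Not at h0
      obtain ⟨k, hki, hkj, hk⟩ := h0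
      refine Or.inr (Or.inr (Or.inr ⟨deriv (deriv ψ) 0, fun a => ?_⟩))
      have hx := deriv_eq_of_sum_const_on_hyperplane hg hc hi hj
        (x := Pi.single i a + Pi.single k ((t - a * v i) / v k)) (by
          simp [Pi.single_apply, add_mul, Finset.sum_add_distrib, hk])
      simpa [hij, hji, hki, hkj, hki.symm, hkj.symm] using hx
  · rintro (⟨i, hi, h0⟩ | ⟨i, j, hij, h0, heq, hnorm, hper⟩ | ⟨i, j, hij, h0, heq, hnorm, hsym⟩ |
      ⟨c, hc⟩)
    · refine ⟨-(deriv ψ (t / v i) * v i), fun x hx => ?_⟩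
      rw [Fintype.sum_eq_single i fun k hk => by rw [h0 k hk, mul_zero]] at hx ⊢
      rw [← hx, mul_div_cancel_right₀ _ hi]
    · have hnorm' : |v j| = (Real.sqrt 2)⁻¹ := by rw [← hnorm, heq, abs_neg]
      have hj : v j ≠ 0 := by
        rw [← abs_pos, hnorm']
        positivity
      have hper' : Function.Periodic (deriv (deriv ψ)) (t * (v j)⁻¹) := by
        rcases inv_eq_or_eq_neg_sqrt_two hnorm' with hs | hs
        · rwa [hs, mul_comm]
        · rw [hs]
          simpa [mul_comm] using hper.neg
      refine exists_sum_const_on_hyperplane_of_pair hg hij h0 hj fun x => ?_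
      rw [← hper' x, heq]
      congr 1
      field_simp
      ring
    · have hj : v j ≠ 0 := by
        rw [← heq, ← abs_pos, hnorm]
        positivity
      refine exists_sum_const_on_hyperplane_of_pair hg hij h0 hj fun x => ?_
      rw [hsym x, heq]
      congr 1
      field_simp
    · have hlin : ∀ y, deriv ψ y = c * y + deriv ψ 0 := by
        intro y
        have hder : ∀ z, HasDerivAt (fun z => deriv ψ z - c * z) 0 z := by
          intro z
          have hz := (hg z).hasDerivAt.sub ((hasDerivAt_id z).const_mul c)
          refine hz.congr_deriv ?_
          rw [hc z]
          ring
        have := is_const_of_deriv_eq_zero (fun z => (hder z).differentiableAt)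
          (fun z => (hder z).deriv) y 0
        linarith
      refine ⟨-(c * t + deriv ψ 0 * ∑ k, v k), fun x hx => ?_⟩
      rw [← hx, Finset.mul_sum, Finset.mul_sum, ← Finset.sum_add_distrib, neg_inj]
      refine Finset.sum_congr rfl fun k _ => ?_
      rw [hlin (x k)]
      ring
end

section
/- Let μ be a probability measure on ℝ with dμ(x) = e^{−v(x)}dx, v ∈ C²(ℝ), and let N ≥ 2. If for every t ∈ ℝ the coordinate half-space H_t = {x ∈ ℝ^N : x_N < t} is stable for the product measure μ^N (equivalently, if v''(t) ≤ λ_μ for every t ∈ ℝ, where λ_μ is the spectral gap of μ), then v'' is constant on ℝ; that is, μ is a Gaussian measure. -/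
open MeasureTheory Real
open scoped ENNReal

/-- Stability of the half-space `H = {x ∈ ℝ^{n+1} : ⟨x,v⟩ < t}` for the product measure
whose density is `e^{φ(x)} = ∏ᵢ e^{ψ(xᵢ)}`; see the paper of Rosales–Cañete–Bayle–Morgan:
for every parametrization of the boundary hyperplane by an affine isometry
`p : ℝⁿ → ℝ^{n+1}` and every `u ∈ C_c^∞(∂H)` with `∫_{∂H} u e^φ da = 0` one has
`∫_{∂H} (|∇_{∂H} u|² + u² ∑ᵢ ψ''(xᵢ) vᵢ²) e^φ da ≥ 0`. -/
def HalfSpaceStable {n : ℕ} (ψ : ℝ → ℝ)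
    (v : EuclideanSpace ℝ (Fin (n + 1))) (t : ℝ) : Prop :=
  ∀ p : EuclideanSpace ℝ (Fin n) →ᵃⁱ[ℝ] EuclideanSpace ℝ (Fin (n + 1)),
    Set.range p = {x : EuclideanSpace ℝ (Fin (n + 1)) | ∑ i, x i * v i = t} →
    ∀ u : EuclideanSpace ℝ (Fin n) → ℝ,
      ContDiff ℝ (⊤ : ℕ∞) u → HasCompactSupport u →
      (∫ z : EuclideanSpace ℝ (Fin n), u z * ∏ i, Real.exp (ψ (p z i))) = 0 →
      0 ≤ ∫ z : EuclideanSpace ℝ (Fin n),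
          (‖gradient u z‖ ^ 2 + u z ^ 2 * ∑ i, deriv (deriv ψ) (p z i) * v i ^ 2) *
            ∏ i, Real.exp (ψ (p z i))

open Filter Topology

lemma tendsto_integral_mul_of_bounded {E : Type*} [TopologicalSpace E] [MeasurableSpace E]
    [OpensMeasurableSpace E] {μ : Measure E} {ρ : E → ℝ} (hρ : Integrable ρ μ)
    {f : ℕ → E → ℝ} {f' : E → ℝ} (hf : ∀ k, Continuous (f k)) {C : ℝ}
    (hC : ∀ k z, |f k z| ≤ C) (hlim : ∀ z, Tendsto (fun k => f k z) atTop (𝓝 (f' z))) :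
    Tendsto (fun k => ∫ z, f k z * ρ z ∂μ) atTop (𝓝 (∫ z, f' z * ρ z ∂μ)) := by
  refine tendsto_integral_of_dominated_convergence (fun z => C * |ρ z|)
    (fun k => ((hf k).aestronglyMeasurable).mul hρ.aestronglyMeasurable)
    (hρ.abs.const_mul C) (fun k => ?_) ?_
  · refine ae_of_all _ fun z => ?_
    rw [norm_mul]
    exact mul_le_mul_of_nonneg_right (hC k z) (abs_nonneg _)
  · exact ae_of_all _ fun z => (hlim z).mul_const _

lemma exists_smooth_cutoff (E : Type*) [NormedAddCommGroup E] [InnerProductSpace ℝ E]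
    [FiniteDimensional ℝ E] :
    ∃ χ : E → ℝ, ContDiff ℝ (⊤ : ℕ∞) χ ∧ HasCompactSupport χ ∧ (∀ z, 0 ≤ χ z) ∧
      (∀ z, χ z ≤ 1) ∧ ∀ z, ‖z‖ ≤ 1 → χ z = 1 := by
  let b : ContDiffBump (0 : E) := ⟨1, 2, one_pos, one_lt_two⟩
  exact ⟨b, b.contDiff, b.hasCompactSupport, fun z => b.nonneg, fun z => b.le_one,
    fun z hz => b.one_of_mem_closedBall (by simpa [b] using hz)⟩

lemma integral_cutoff_mul_second_deriv_nonneg {v : ℝ → ℝ} (hv : ContDiff ℝ 2 v) {χ h h' : ℝ → ℝ}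
    (hχ : ContDiff ℝ 2 χ) (hc : HasCompactSupport χ) (hχ0 : ∀ x, 0 ≤ χ x)
    (hh : ∀ x, HasDerivAt h (h' x) x) (hh' : Continuous h') :
    0 ≤ ∫ x, (χ x * h x ^ 2 + χ x * deriv (deriv v) x + deriv (deriv χ) x
      - 2 * deriv χ x * h x - 2 * χ x * h' x) * exp (-v x) := by
  have hhc : Continuous h := continuous_iff_continuousAt.2 fun x => (hh x).continuousAt
  have hv1 : ContDiff ℝ 1 (deriv v) := hv.deriv'
  have hχ1 : ContDiff ℝ 1 (deriv χ) := hχ.deriv'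
  have cv := hv.continuous
  have cv1 := hv1.continuous
  have cv2 := hv1.continuous_deriv_one
  have cχ := hχ.continuous
  have cχ1 := hχ1.continuous
  have cχ2 := hχ1.continuous_deriv_one
  have dv : ∀ x, HasDerivAt v (deriv v x) x := fun x =>
    (hv.differentiable (by norm_num) x).hasDerivAt
  have dv1 : ∀ x, HasDerivAt (deriv v) (deriv (deriv v) x) x := fun x =>
    (hv1.differentiable (by norm_num) x).hasDerivAt
  have dχ : ∀ x, HasDerivAt χ (deriv χ x) x := fun x =>
    (hχ.differentiable (by norm_num) x).hasDerivAt
  have dχ1 : ∀ x, HasDerivAt (deriv χ) (deriv (deriv χ) x) x := fun x =>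
    (hχ1.differentiable (by norm_num) x).hasDerivAt
  let G : ℝ → ℝ := fun x => (χ x * h x ^ 2 + χ x * deriv (deriv v) x + deriv (deriv χ) x
      - 2 * deriv χ x * h x - 2 * χ x * h' x) * exp (-v x)
  let Q : ℝ → ℝ := fun x => (χ x * (deriv v x - h x) ^ 2) * exp (-v x)
  let F : ℝ → ℝ := fun x => (χ x * deriv v x + deriv χ x - 2 * (χ x * h x)) * exp (-v x)
  have dF : ∀ x, HasDerivAt F (G x - Q x) x := by
    intro x
    have := ((((dχ x).mul (dv1 x)).add (dχ1 x)).sub (((dχ x).mul (hh x)).const_mul 2)).mul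
      (dv x).neg.exp
    refine this.congr_deriv ?_
    simp only [G, Q, Pi.add_apply, Pi.sub_apply, Pi.mul_apply, Pi.neg_apply]
    ring
  have hzero : ∀ x, x ∉ tsupport χ → χ x = 0 ∧ deriv χ x = 0 ∧ deriv (deriv χ) x = 0 := by
    intro x hx
    have h1 : x ∉ tsupport (deriv χ) := fun h => hx (tsupport_deriv_subset h)
    have h2 : x ∉ tsupport (deriv (deriv χ)) := fun h => h1 (tsupport_deriv_subset h)
    exact ⟨image_eq_zero_of_notMem_tsupport hx, image_eq_zero_of_notMem_tsupport h1,
      image_eq_zero_of_notMem_tsupport h2⟩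
  have iG : Integrable G := by
    refine Continuous.integrable_of_hasCompactSupport (by fun_prop)
      (HasCompactSupport.intro hc fun x hx => ?_)
    obtain ⟨a, b, c⟩ := hzero x hx
    simp [G, a, b, c]
  have iQ : Integrable Q := by
    refine Continuous.integrable_of_hasCompactSupport (by fun_prop)
      (HasCompactSupport.intro hc fun x hx => ?_)
    obtain ⟨a, b, c⟩ := hzero x hx
    simp [Q, a]
  have iF : Integrable F := by
    refine Continuous.integrable_of_hasCompactSupport (by fun_prop)
      (HasCompactSupport.intro hc fun x hx => ?_)
    obtain ⟨a, b, c⟩ := hzero x hx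
    simp [F, a, b]
  have key := integral_eq_zero_of_hasDerivAt_of_integrable dF (iG.sub iQ) iF
  rw [integral_sub iG iQ, sub_eq_zero] at key
  change 0 ≤ ∫ x, G x
  rw [key]
  exact integral_nonneg fun x => by have := hχ0 x; positivity

lemma integrable_of_prob {v : ℝ → ℝ} (hprob : (∫ x : ℝ, exp (-v x)) = 1) :
    Integrable (fun x => exp (-v x)) := by
  by_contra h
  rw [integral_undef h] at hprob
  exact zero_ne_one hprob

lemma integrable_mul_of_bounded {E : Type*} [TopologicalSpace E] [MeasurableSpace E]
    [OpensMeasurableSpace E] {μ : Measure E} {ρ f : E → ℝ} (hρ : Integrable ρ μ)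
    (hf : Continuous f) {C : ℝ} (hC : ∀ z, |f z| ≤ C) : Integrable (fun z => f z * ρ z) μ :=
  hρ.bdd_mul hf.aestronglyMeasurable (ae_of_all _ hC)

set_option maxHeartbeats 800000 in
lemma integral_cutoff_deficit_le {v : ℝ → ℝ} (hv : ContDiff ℝ 2 v)
    (hprob : (∫ x : ℝ, exp (-v x)) = 1) {L : ℝ} (hL : ∀ x, deriv (deriv v) x ≤ L)
    {h h' : ℝ → ℝ} (hh : ∀ x, HasDerivAt h (h' x) x) (hh' : Continuous h') {B B' : ℝ}
    (hB : ∀ x, |h x| ≤ B) (hB' : ∀ x, |h' x| ≤ B') {θ : ℝ → ℝ} (hθ : Continuous θ)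
    (hθc : HasCompactSupport θ) (hθ1 : ∀ x, θ x ≤ 1) :
    ∫ x, θ x * (L - deriv (deriv v) x) * exp (-v x) ≤
      ∫ x, (L + h x ^ 2 - 2 * h' x) * exp (-v x) := by
  have hρ := integrable_of_prob hprob
  have hhc : Continuous h := continuous_iff_continuousAt.2 fun x => (hh x).continuousAt
  obtain ⟨χ, hχ, hc, hχ0, hχ1, hχone⟩ := exists_smooth_cutoff ℝ
  have hχ2 : ContDiff ℝ 2 χ := by exact_mod_cast contDiff_infty.1 hχ 2
  have hχd : ContDiff ℝ 1 (deriv χ) := hχ2.deriv'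
  have cχ := hχ.continuous
  have cχd := hχd.continuous
  have cχdd := hχd.continuous_deriv_one
  have cv := hv.continuous
  have hv1 : ContDiff ℝ 1 (deriv v) := hv.deriv'
  have cv2 := hv1.continuous_deriv_one
  obtain ⟨C1, hC1⟩ := hc.deriv.exists_bound_of_continuous cχd
  obtain ⟨C2, hC2⟩ := hc.deriv.deriv.exists_bound_of_continuous cχdd
  let r : ℕ → ℝ := fun k => ((k : ℝ) + 1)⁻¹
  have hr0 : ∀ k, 0 < r k := fun k => by positivity
  have hr1 : ∀ k, r k ≤ 1 := fun k => by
    simp only [r]; exact inv_le_one_of_one_le₀ (le_add_of_nonneg_left k.cast_nonneg)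
  have hrlim : Tendsto r atTop (𝓝 0) := by
    simpa only [one_div] using tendsto_one_div_add_atTop_nhds_zero_nat (𝕜 := ℝ)
  let T : ℕ → ℝ → ℝ := fun k x => L * χ (r k * x) + χ (r k * x) * h x ^ 2
    + r k * (r k * deriv (deriv χ) (r k * x)) - 2 * (r k * deriv χ (r k * x)) * h x
    - 2 * χ (r k * x) * h' x
  have hTc : ∀ k, Continuous (T k) := fun k => by fun_prop
  have hB0 : 0 ≤ B := (abs_nonneg _).trans (hB 0)
  have hC10 : 0 ≤ C1 := (norm_nonneg _).trans (hC1 0)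
  have hC20 : 0 ≤ C2 := (norm_nonneg _).trans (hC2 0)
  have hTb : ∀ k x, |T k x| ≤ |L| + B ^ 2 + C2 + 2 * C1 * B + 2 * B' := by
    intro k x
    have e1 : |χ (r k * x)| ≤ 1 := abs_le.2 ⟨by linarith [hχ0 (r k * x)], hχ1 _⟩
    have e2 : |r k| ≤ 1 := abs_le.2 ⟨by linarith [hr0 k], hr1 k⟩
    have e3 := hC1 (r k * x)
    have e4 := hC2 (r k * x)
    rw [Real.norm_eq_abs] at e3 e4
    have a1 : |L * χ (r k * x)| ≤ |L| := by
      rw [abs_mul]; exact mul_le_of_le_one_right (abs_nonneg _) e1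
    have a2 : |χ (r k * x) * h x ^ 2| ≤ 1 * B ^ 2 := by
      rw [abs_mul, abs_pow]; gcongr; exact hB x
    have a3 : |r k * (r k * deriv (deriv χ) (r k * x))| ≤ 1 * (1 * C2) := by
      rw [abs_mul, abs_mul]; gcongr
    have a4 : |2 * (r k * deriv χ (r k * x)) * h x| ≤ 2 * (1 * C1) * B := by
      rw [abs_mul, abs_mul, abs_mul, abs_two]; gcongr; exact hB x
    have a5 : |2 * χ (r k * x) * h' x| ≤ 2 * 1 * B' := by
      rw [abs_mul, abs_mul, abs_two]; gcongr; exact hB' x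
    simp only [T]
    obtain ⟨p1, q1⟩ := abs_le.1 a1
    obtain ⟨p2, q2⟩ := abs_le.1 a2
    obtain ⟨p3, q3⟩ := abs_le.1 a3
    obtain ⟨p4, q4⟩ := abs_le.1 a4
    obtain ⟨p5, q5⟩ := abs_le.1 a5
    exact abs_le.2 ⟨by linarith, by linarith⟩
  have hTlim : ∀ x, Tendsto (fun k => T k x) atTop (𝓝 (L + h x ^ 2 - 2 * h' x)) := by
    intro x
    have hx : Tendsto (fun k => r k * x) atTop (𝓝 0) := by simpa using hrlim.mul_const x
    have h1 : Tendsto (fun k => χ (r k * x)) atTop (𝓝 1) := by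
      have := (cχ.tendsto 0).comp hx
      rwa [hχone 0 (by simp)] at this
    have h2 := (cχd.tendsto 0).comp hx
    have h3 := (cχdd.tendsto 0).comp hx
    have := ((((h1.const_mul L).add (h1.mul_const (h x ^ 2))).add
      (hrlim.mul (hrlim.mul h3))).sub (((hrlim.mul h2).const_mul 2).mul_const (h x))).sub
      ((h1.const_mul 2).mul_const (h' x))
    have e : L * 1 + 1 * h x ^ 2 + 0 * (0 * deriv (deriv χ) 0) - 2 * (0 * deriv χ 0) * h x
        - 2 * 1 * h' x = L + h x ^ 2 - 2 * h' x := by ring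
    rw [e] at this
    exact this
  refine ge_of_tendsto (tendsto_integral_mul_of_bounded hρ hTc hTb hTlim) ?_
  obtain ⟨A, hA⟩ := hθc.isBounded.exists_norm_le
  have hev : ∀ᶠ k in atTop, r k * A ≤ 1 := by
    have : Tendsto (fun k => r k * A) atTop (𝓝 0) := by simpa using hrlim.mul_const A
    exact this.eventually_le_const one_pos
  filter_upwards [hev] with k hk
  have hcr : HasCompactSupport fun x => χ (r k * x) := hc.comp_smul (hr0 k).ne'
  have d1 : deriv (fun x => χ (r k * x)) = fun x => r k * deriv χ (r k * x) := by
    ext x; exact deriv_comp_mul_left (r k) χ x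
  have d2 : deriv (deriv (fun x => χ (r k * x))) =
      fun x => r k * (r k * deriv (deriv χ) (r k * x)) := by
    rw [d1]; ext x
    rw [deriv_const_mul_field]
    congr 1
    exact deriv_comp_mul_left (r k) (deriv χ) x
  have main := integral_cutoff_mul_second_deriv_nonneg hv (χ := fun x => χ (r k * x))
    (hχ2.comp (contDiff_const.mul contDiff_id)) hcr (fun x => hχ0 _) hh hh'
  rw [d2, d1] at main
  have iD : Integrable fun x => χ (r k * x) * (L - deriv (deriv v) x) * exp (-v x) :=
    Continuous.integrable_of_hasCompactSupport (by fun_prop) (hcr.mul_right.mul_right)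
  have iθ : Integrable fun x => θ x * (L - deriv (deriv v) x) * exp (-v x) :=
    Continuous.integrable_of_hasCompactSupport (by fun_prop) (hθc.mul_right.mul_right)
  have iT : Integrable fun x => T k x * exp (-v x) :=
    integrable_mul_of_bounded hρ (hTc k) (hTb k)
  calc ∫ x, θ x * (L - deriv (deriv v) x) * exp (-v x)
      ≤ ∫ x, χ (r k * x) * (L - deriv (deriv v) x) * exp (-v x) := by
        refine integral_mono iθ iD fun x => ?_
        have hle : θ x ≤ χ (r k * x) := by
          by_cases hx : x ∈ tsupport θ
          · rw [hχone]
            · exact hθ1 x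
            · rw [norm_mul, Real.norm_of_nonneg (hr0 k).le]
              exact (mul_le_mul_of_nonneg_left (hA x hx) (hr0 k).le).trans hk
          · rw [image_eq_zero_of_notMem_tsupport hx]; exact hχ0 _
        have := hL x
        have : 0 ≤ L - deriv (deriv v) x := by linarith
        dsimp only
        gcongr
    _ ≤ ∫ x, T k x * exp (-v x) := by
        rw [← sub_nonneg, ← integral_sub iT iD]
        refine main.trans_eq (integral_congr_ae (ae_of_all _ fun x => ?_))
        simp only [T]; ring

set_option maxHeartbeats 800000 in
lemma variance_le_of_compactly_supported {E : Type*} [NormedAddCommGroup E]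
    [InnerProductSpace ℝ E] [FiniteDimensional ℝ E] [MeasurableSpace E] [BorelSpace E]
    {μ : Measure E} {ρ : E → ℝ} (hρ : Integrable ρ μ) (hρ1 : ∫ z, ρ z ∂μ = 1) {lam : ℝ}
    (hlam : ∀ u : E → ℝ, ContDiff ℝ (⊤ : ℕ∞) u → HasCompactSupport u → ∫ z, u z * ρ z ∂μ = 0 →
      lam * ∫ z, u z ^ 2 * ρ z ∂μ ≤ ∫ z, ‖fderiv ℝ u z‖ ^ 2 * ρ z ∂μ)
    {f : E → ℝ} (hf : ContDiff ℝ (⊤ : ℕ∞) f) {B D : ℝ} (hB : ∀ z, |f z| ≤ B)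
    (hD : ∀ z, ‖fderiv ℝ f z‖ ≤ D) :
    lam * ∫ z, (f z - ∫ y, f y * ρ y ∂μ) ^ 2 * ρ z ∂μ ≤ ∫ z, ‖fderiv ℝ f z‖ ^ 2 * ρ z ∂μ := by
  set m := ∫ y, f y * ρ y ∂μ
  obtain ⟨χ, hχ, hc, hχ0, hχ1, hχone⟩ := exists_smooth_cutoff E
  have cχ := hχ.continuous
  have cf := hf.continuous
  have cdχ : Continuous (fderiv ℝ χ) := hχ.continuous_fderiv (by simp)
  obtain ⟨C, hC⟩ := (hc.fderiv (𝕜 := ℝ)).exists_bound_of_continuous cdχ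
  let r : ℕ → ℝ := fun k => ((k : ℝ) + 1)⁻¹
  have hr0 : ∀ k, 0 < r k := fun k => by positivity
  have hr1 : ∀ k, r k ≤ 1 := fun k => by
    simp only [r]; exact inv_le_one_of_one_le₀ (le_add_of_nonneg_left k.cast_nonneg)
  have hrlim : Tendsto r atTop (𝓝 0) := by
    simpa only [one_div] using tendsto_one_div_add_atTop_nhds_zero_nat (𝕜 := ℝ)
  let η : ℕ → E → ℝ := fun k z => χ (r k • z)
  have hηs : ∀ k, ContDiff ℝ (⊤ : ℕ∞) (η k) := fun k => hχ.comp (contDiff_const_smul (r k))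
  have cη : ∀ k, Continuous (η k) := fun k => (hηs k).continuous
  have hηc : ∀ k, HasCompactSupport (η k) := fun k => hc.comp_smul (hr0 k).ne'
  have hη1 : ∀ k z, |η k z| ≤ 1 := fun k z =>
    abs_le.2 ⟨by linarith [hχ0 (r k • z)], hχ1 _⟩
  have hz : ∀ z : E, Tendsto (fun k => r k • z) atTop (𝓝 0) := fun z => by
    simpa using hrlim.smul_const z
  have hηlim : ∀ z, Tendsto (fun k => η k z) atTop (𝓝 1) := fun z => by
    have := (cχ.tendsto 0).comp (hz z)
    rwa [hχone 0 (by simp)] at this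
  have hB0 : 0 ≤ B := (abs_nonneg _).trans (hB 0)
  have hC0 : 0 ≤ C := (norm_nonneg _).trans (hC 0)
  have hηf : ∀ k z, |f z * η k z| ≤ B := fun k z => by
    rw [abs_mul]
    exact (mul_le_of_le_one_right (abs_nonneg _) (hη1 k z)).trans (hB z)
  have lη : Tendsto (fun k => ∫ z, η k z * ρ z ∂μ) atTop (𝓝 1) := by
    have := tendsto_integral_mul_of_bounded hρ cη hη1 hηlim
    simpa [hρ1] using this
  have lf : Tendsto (fun k => ∫ z, (f z * η k z) * ρ z ∂μ) atTop (𝓝 m) :=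
    tendsto_integral_mul_of_bounded hρ (fun k => cf.mul (cη k)) hηf
      fun z => by simpa using (hηlim z).const_mul (f z)
  let c : ℕ → ℝ := fun k => (∫ z, (f z * η k z) * ρ z ∂μ) / ∫ z, η k z * ρ z ∂μ
  have lc : Tendsto c atTop (𝓝 m) := by
    have := lf.div lη one_ne_zero
    rwa [div_one] at this
  obtain ⟨K, hK⟩ := (Metric.isBounded_range_of_tendsto c lc).exists_norm_le
  have hcK : ∀ k, |c k| ≤ K := fun k => hK _ ⟨k, rfl⟩
  have hK0 : 0 ≤ K := (abs_nonneg _).trans (hcK 0)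
  let u : ℕ → E → ℝ := fun k z => (f z - c k) * η k z
  have hus : ∀ k, ContDiff ℝ (⊤ : ℕ∞) (u k) := fun k => (hf.sub contDiff_const).mul (hηs k)
  have hfc : ∀ k z, |f z - c k| ≤ B + K := fun k z =>
    (abs_sub _ _).trans (add_le_add (hB z) (hcK k))
  have hdη : ∀ k z, HasFDerivAt (η k) (r k • fderiv ℝ χ (r k • z)) z := fun k z => by
    have h1 : HasFDerivAt χ (fderiv ℝ χ (r k • z)) (r k • z) :=
      (hχ.differentiable (by simp) _).hasFDerivAt
    have h2 : HasFDerivAt (fun y : E => r k • y) (r k • ContinuousLinearMap.id ℝ E) z :=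
      (hasFDerivAt_id z).const_smul (r k)
    have := h1.comp z h2
    refine this.congr_fderiv ?_
    ext y
    simp
  have hdu : ∀ k z, fderiv ℝ (u k) z =
      (f z - c k) • r k • fderiv ℝ χ (r k • z) + η k z • fderiv ℝ f z := fun k z =>
    (((hf.differentiable (by simp) z).hasFDerivAt.sub_const (c k)).mul (hdη k z)).fderiv
  have hev : ∀ᶠ k in atTop,
      lam * ∫ z, u k z ^ 2 * ρ z ∂μ ≤ ∫ z, ‖fderiv ℝ (u k) z‖ ^ 2 * ρ z ∂μ := by
    filter_upwards [lη.eventually_ne one_ne_zero] with k hk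
    refine hlam (u k) (hus k) (hηc k).mul_left ?_
    have e : ∀ z, u k z * ρ z = (f z * η k z) * ρ z - c k * (η k z * ρ z) := fun z => by
      simp only [u]; ring
    simp_rw [e]
    rw [integral_sub (integrable_mul_of_bounded (f := fun z => f z * η k z) hρ (cf.mul (cη k)) (hηf k))
      ((integrable_mul_of_bounded hρ (cη k) (hη1 k)).const_mul _), integral_const_mul]
    simp only [c]
    rw [div_mul_cancel₀ _ hk, sub_self]
  have l1 : Tendsto (fun k => ∫ z, u k z ^ 2 * ρ z ∂μ) atTop
      (𝓝 (∫ z, (f z - m) ^ 2 * ρ z ∂μ)) := by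
    refine tendsto_integral_mul_of_bounded hρ (fun k => ((hus k).continuous).pow 2)
      (C := ((B + K) * 1) ^ 2) (fun k z => ?_) fun z => ?_
    · rw [abs_pow, abs_mul]
      have h1 := hfc k z
      have h2 := hη1 k z
      gcongr
    · simpa using (((lc.const_sub (f z)).mul (hηlim z)).pow 2)
  have l2 : Tendsto (fun k => ∫ z, ‖fderiv ℝ (u k) z‖ ^ 2 * ρ z ∂μ) atTop
      (𝓝 (∫ z, ‖fderiv ℝ f z‖ ^ 2 * ρ z ∂μ)) := by
    refine tendsto_integral_mul_of_bounded hρ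
      (fun k => (((hus k).continuous_fderiv (by simp)).norm).pow 2)
      (C := ((B + K) * (1 * C) + 1 * D) ^ 2) (fun k z => ?_) fun z => ?_
    · rw [abs_pow, abs_norm, hdu]
      refine pow_le_pow_left₀ (norm_nonneg _) ((norm_add_le _ _).trans (add_le_add ?_ ?_)) 2
      · rw [norm_smul, norm_smul]
        refine mul_le_mul (hfc k z) (mul_le_mul ?_ (hC _) (norm_nonneg _) one_pos.le)
          (by positivity) (by positivity)
        rw [Real.norm_of_nonneg (hr0 k).le]
        exact hr1 k
      · rw [norm_smul]
        exact mul_le_mul (hη1 k z) (hD z) (norm_nonneg _) one_pos.le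
    · simp_rw [hdu]
      have h1 := (cdχ.tendsto 0).comp (hz z)
      have := ((lc.const_sub (f z)).smul (hrlim.smul h1)).add
        ((hηlim z).smul_const (fderiv ℝ f z))
      simp only [zero_smul, smul_zero, zero_add, one_smul] at this
      exact this.norm.pow 2
  exact le_of_tendsto_of_tendsto (l1.const_mul lam) l2 hev

lemma integral_coordinate_mul_prod {n : ℕ} {w : ℝ → ℝ} (hw : ∫ x, w x = 1) (F : ℝ → ℝ) :
    ∫ z : EuclideanSpace ℝ (Fin (n + 1)), F (z 0) * ∏ i, w (z i) = ∫ x, F x * w x := by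
  have h := (PiLp.volume_preserving_ofLp (Fin (n + 1))).integral_comp
    (MeasurableEquiv.toLp 2 (Fin (n + 1) → ℝ)).symm.measurableEmbedding
    (fun z : Fin (n + 1) → ℝ => F (z 0) * ∏ i, w (z i))
  refine h.trans ?_
  let q : Fin (n + 1) → ℝ → ℝ := Fin.cons (fun x => F x * w x) fun _ => w
  have e : ∀ z : Fin (n + 1) → ℝ, F (z 0) * ∏ i, w (z i) = ∏ i, q i (z i) := fun z => by
    rw [Fin.prod_univ_succ, Fin.prod_univ_succ]
    simp [q, mul_assoc]
  simp_rw [e]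
  rw [volume_pi, integral_fintype_prod_eq_prod, Fin.prod_univ_succ]
  simp [q, hw]

lemma exists_snoc_affineIsometry (n : ℕ) (t : ℝ) :
    ∃ p : EuclideanSpace ℝ (Fin n) →ᵃⁱ[ℝ] EuclideanSpace ℝ (Fin (n + 1)),
      (∀ z i, p z (Fin.castSucc i) = z i) ∧ ∀ z, p z (Fin.last n) = t := by
  let s : ℝ → EuclideanSpace ℝ (Fin n) → EuclideanSpace ℝ (Fin (n + 1)) := fun a z =>
    WithLp.toLp 2 (Fin.snoc (α := fun _ => ℝ) z.ofLp a)
  let l : EuclideanSpace ℝ (Fin n) →ₗ[ℝ] EuclideanSpace ℝ (Fin (n + 1)) :=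
    { toFun := s 0
      map_add' := fun x y => by
        ext i
        refine Fin.lastCases ?_ (fun j => ?_) i <;> simp [s]
      map_smul' := fun a x => by
        ext i
        refine Fin.lastCases ?_ (fun j => ?_) i <;> simp [s] }
  refine ⟨⟨⟨s t, l, fun x y => ?_⟩, fun x => ?_⟩, fun z i => ?_, fun z => ?_⟩
  · ext i
    refine Fin.lastCases ?_ (fun j => ?_) i <;> simp [s, l]
  · simp [EuclideanSpace.norm_eq, Fin.sum_univ_castSucc, l, s]
  · change s t z (Fin.castSucc i) = z i
    simp [s]
  · change s t z (Fin.last n) = t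
    simp [s]

lemma HalfSpaceStable.deriv2_mul_integral_sq_le {n : ℕ} {v : ℝ → ℝ} (hv : ContDiff ℝ 2 v) {t : ℝ}
    (hst : HalfSpaceStable (n := n) (fun x => -v x) (EuclideanSpace.single (Fin.last n) 1) t)
    {u : EuclideanSpace ℝ (Fin n) → ℝ} (hu : ContDiff ℝ (⊤ : ℕ∞) u) (huc : HasCompactSupport u)
    (hu0 : ∫ z, u z * ∏ i, exp (-v (z i)) = 0) :
    deriv (deriv v) t * ∫ z, u z ^ 2 * ∏ i, exp (-v (z i)) ≤
      ∫ z, ‖fderiv ℝ u z‖ ^ 2 * ∏ i, exp (-v (z i)) := by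
  obtain ⟨p, hp, hpt⟩ := exists_snoc_affineIsometry n t
  have hsum : ∀ F : Fin (n + 1) → ℝ,
      ∑ i, F i * (EuclideanSpace.single (Fin.last n) (1 : ℝ) : EuclideanSpace ℝ (Fin (n + 1))) i
        = F (Fin.last n) := fun F => by
    simp
  have cv := hv.continuous
  have cu := hu.continuous
  have cdu : Continuous (fderiv ℝ u) := hu.continuous_fderiv (by simp)
  have hrange : Set.range p = {x : EuclideanSpace ℝ (Fin (n + 1)) | ∑ i, x i *
      (EuclideanSpace.single (Fin.last n) (1 : ℝ) : EuclideanSpace ℝ (Fin (n + 1))) i = t} := by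
    ext x
    rw [Set.mem_ofPred_eq, hsum]
    constructor
    · rintro ⟨z, rfl⟩
      exact hpt z
    · intro hx
      refine ⟨WithLp.toLp 2 fun i => x (Fin.castSucc i), ?_⟩
      ext i
      refine Fin.lastCases ?_ (fun j => ?_) i
      · rw [hpt, hx]
      · rw [hp]
  have hprod : ∀ z, ∏ i, exp (-v (p z i)) = (∏ i, exp (-v (z i))) * exp (-v t) := fun z => by
    rw [Fin.prod_univ_castSucc, hpt]
    simp_rw [hp]
  have h2 : deriv (deriv fun x => -v x) = fun x => -deriv (deriv v) x := by
    have : deriv (fun x => -v x) = fun x => -deriv v x := by ext x; exact deriv.fun_neg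
    rw [this]; ext x; exact deriv.fun_neg
  have main := hst p hrange u hu huc (by
    simp_rw [hprod, ← mul_assoc]
    rw [integral_mul_const, hu0, zero_mul])
  have e : ∀ z, (‖gradient u z‖ ^ 2 + u z ^ 2 * ∑ i, deriv (deriv fun x => -v x) (p z i) *
      (EuclideanSpace.single (Fin.last n) (1 : ℝ) : EuclideanSpace ℝ (Fin (n + 1))) i ^ 2) *
        ∏ i, exp (-v (p z i)) = (‖fderiv ℝ u z‖ ^ 2 * ∏ i, exp (-v (z i)) -
          deriv (deriv v) t * (u z ^ 2 * ∏ i, exp (-v (z i)))) * exp (-v t) := fun z => by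
    have e1 : ‖gradient u z‖ = ‖fderiv ℝ u z‖ := by simp [gradient]
    have e2 : ∑ i, deriv (deriv fun x => -v x) (p z i) *
        (EuclideanSpace.single (Fin.last n) (1 : ℝ) : EuclideanSpace ℝ (Fin (n + 1))) i ^ 2 =
          -deriv (deriv v) t := by
      rw [h2]
      simp [hpt]
    rw [e1, e2, hprod]
    ring
  simp_rw [e] at main
  have i1 : Integrable fun z => ‖fderiv ℝ u z‖ ^ 2 * ∏ i, exp (-v (z i)) := by
    refine Continuous.integrable_of_hasCompactSupport (by fun_prop)
      (HasCompactSupport.intro (huc.fderiv (𝕜 := ℝ)) fun z hz => ?_)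
    rw [image_eq_zero_of_notMem_tsupport hz]; simp
  have i2 : Integrable fun z => u z ^ 2 * ∏ i, exp (-v (z i)) := by
    refine Continuous.integrable_of_hasCompactSupport (by fun_prop)
      (HasCompactSupport.intro huc fun z hz => ?_)
    rw [image_eq_zero_of_notMem_tsupport hz]; simp
  rw [integral_mul_const, integral_sub i1 (i2.const_mul _), integral_const_mul] at main
  have := nonneg_of_mul_nonneg_left main (exp_pos _)
  linarith

lemma deriv2_mul_variance_le {n : ℕ} {v : ℝ → ℝ} (hv : ContDiff ℝ 2 v)
    (hprob : (∫ x : ℝ, exp (-v x)) = 1) {t : ℝ}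
    (hst : HalfSpaceStable (n := n + 1) (fun x => -v x)
      (EuclideanSpace.single (Fin.last (n + 1)) 1) t)
    {g : ℝ → ℝ} (hg : ContDiff ℝ (⊤ : ℕ∞) g) {B D : ℝ} (hB : ∀ x, |g x| ≤ B)
    (hD : ∀ x, |deriv g x| ≤ D) :
    deriv (deriv v) t * ∫ x, (g x - ∫ y, g y * exp (-v y)) ^ 2 * exp (-v x) ≤
      ∫ x, deriv g x ^ 2 * exp (-v x) := by
  have hρ1 := integral_coordinate_mul_prod (n := n) hprob fun _ => 1
  simp only [one_mul, hprob] at hρ1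
  have hρ : Integrable fun z : EuclideanSpace ℝ (Fin (n + 1)) => ∏ i, exp (-v (z i)) := by
    by_contra h
    rw [integral_undef h] at hρ1
    exact zero_ne_one hρ1
  let f : EuclideanSpace ℝ (Fin (n + 1)) → ℝ := fun z => g (z 0)
  have hf : ContDiff ℝ (⊤ : ℕ∞) f := hg.comp (by fun_prop)
  have hdg : ∀ x, HasDerivAt g (deriv g x) x := fun x =>
    (hg.differentiable (by simp) x).hasDerivAt
  have hdf : ∀ z, ‖fderiv ℝ f z‖ ≤ |deriv g (z 0)| := fun z => by
    have h1 : HasFDerivAt f (deriv g (z 0) • EuclideanSpace.proj (𝕜 := ℝ) (0 : Fin (n + 1))) z :=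
      (hdg (z 0)).comp_hasFDerivAt z
        (EuclideanSpace.proj (𝕜 := ℝ) (0 : Fin (n + 1))).hasFDerivAt
    rw [h1.fderiv, norm_smul, Real.norm_eq_abs]
    refine mul_le_of_le_one_right (abs_nonneg _) ?_
    refine ContinuousLinearMap.opNorm_le_bound _ zero_le_one fun y => ?_
    rw [one_mul]
    exact PiLp.norm_apply_le y 0
  have key := variance_le_of_compactly_supported hρ hρ1
    (fun u hu huc hu0 => hst.deriv2_mul_integral_sq_le hv hu huc hu0) hf (fun z => hB _)
    (fun z => (hdf z).trans (hD _))
  rw [integral_coordinate_mul_prod (n := n) hprob g,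
    integral_coordinate_mul_prod (n := n) hprob
      fun x => (g x - ∫ y, g y * exp (-v y)) ^ 2] at key
  refine key.trans ?_
  rw [← integral_coordinate_mul_prod (n := n) hprob fun x => deriv g x ^ 2]
  have cg : Continuous (deriv g) := hg.continuous_deriv (by simp)
  refine integral_mono_of_nonneg (ae_of_all _ fun z => ?_)
    (integrable_mul_of_bounded (C := D ^ 2) hρ (by fun_prop) fun z => ?_)
    (ae_of_all _ fun z => ?_)
  · dsimp only [Pi.zero_apply]; positivity
  · rw [abs_pow]
    exact pow_le_pow_left₀ (abs_nonneg _) (hD _) 2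
  · dsimp only
    rw [← sq_abs (deriv g _)]
    gcongr
    exact hdf z

/-- If for a probability measure `dμ = e^{-v} dx` on `ℝ` every coordinate half-space
`H_t = {x ∈ ℝ^N : x_N < t}`, `t ∈ ℝ`, is stable for the product measure `μ^N`
(here `N = M + 2 ≥ 2`), then `v''` is constant, i.e. `μ` is Gaussian. -/
theorem all_coordinate_halfspaces_stable_implies_gaussian
    (M : ℕ) (v : ℝ → ℝ) (hv : ContDiff ℝ 2 v)
    (hprob : (∫ x : ℝ, Real.exp (-v x)) = 1)
    (hstab : ∀ t : ℝ, HalfSpaceStable (n := M + 1) (fun x => -v x)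
        (EuclideanSpace.single (Fin.last (M + 1)) 1) t) :
    ∃ c : ℝ, ∀ x : ℝ, deriv (deriv v) x = c := by
  have hρ := integrable_of_prob hprob
  have cv := hv.continuous
  have hv1 : ContDiff ℝ 1 (deriv v) := hv.deriv'
  have cv2 : Continuous (deriv (deriv v)) := hv1.continuous_deriv_one
  let g : ℕ → ℝ → ℝ := fun k x => ((k : ℝ) + 1) * sin (((k : ℝ) + 1)⁻¹ * x)
  let m : ℕ → ℝ := fun k => ∫ y, g k y * exp (-v y)
  have hgs : ∀ k, ContDiff ℝ (⊤ : ℕ∞) (g k) := fun k =>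
    contDiff_const.mul (contDiff_sin.comp (contDiff_const.mul contDiff_id))
  have hk0 : ∀ k : ℕ, (0 : ℝ) < k + 1 := fun k => by positivity
  have hgd : ∀ k x, HasDerivAt (g k) (cos (((k : ℝ) + 1)⁻¹ * x)) x := fun k x => by
    refine ((((hasDerivAt_id x).const_mul ((k : ℝ) + 1)⁻¹).sin).const_mul
      ((k : ℝ) + 1)).congr_deriv ?_
    have := (hk0 k).ne'
    simp only [id]
    field_simp
  have hgd' : ∀ k, deriv (g k) = fun x => cos (((k : ℝ) + 1)⁻¹ * x) := fun k =>
    funext fun x => (hgd k x).deriv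
  have hgB : ∀ k x, |g k x| ≤ (k : ℝ) + 1 := fun k x => by
    simp only [g]
    rw [abs_mul, abs_of_pos (hk0 k)]
    exact mul_le_of_le_one_right (hk0 k).le (abs_sin_le_one _)
  have poincare : ∀ k t, deriv (deriv v) t * ∫ x, (g k x - m k) ^ 2 * exp (-v x) ≤
      ∫ x, cos (((k : ℝ) + 1)⁻¹ * x) ^ 2 * exp (-v x) := fun k t => by
    have := deriv2_mul_variance_le hv hprob (hstab t) (hgs k) (hgB k) (D := 1)
      (fun x => by rw [hgd']; exact abs_cos_le_one _)
    rwa [hgd'] at this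
  have cg : ∀ k, Continuous (g k) := fun k => (hgs k).continuous
  have iV : ∀ k, Integrable fun x => (g k x - m k) ^ 2 * exp (-v x) := fun k =>
    integrable_mul_of_bounded hρ (((cg k).sub continuous_const).pow 2)
      (C := ((k : ℝ) + 1 + |m k|) ^ 2) fun x => by
        rw [abs_pow]
        exact pow_le_pow_left₀ (abs_nonneg _)
          ((abs_sub _ _).trans (add_le_add_left (hgB k x) _)) 2
  have iC : ∀ k : ℕ, Integrable fun x => cos (((k : ℝ) + 1)⁻¹ * x) * exp (-v x) := fun k =>
    integrable_mul_of_bounded hρ (by fun_prop) fun x => abs_cos_le_one _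
  have iC2 : ∀ k : ℕ, Integrable fun x => cos (((k : ℝ) + 1)⁻¹ * x) ^ 2 * exp (-v x) := fun k =>
    integrable_mul_of_bounded hρ (by fun_prop) (C := 1) fun x => by
      rw [abs_pow]; exact pow_le_one₀ (abs_nonneg _) (abs_cos_le_one _)
  have hvar : 0 < ∫ x, (g 0 x - m 0) ^ 2 * exp (-v x) := by
    have hn : ∀ x, 0 ≤ (g 0 x - m 0) ^ 2 * exp (-v x) := fun x => by positivity
    have hcont : Continuous fun x => (g 0 x - m 0) ^ 2 * exp (-v x) :=
      (((cg 0).sub continuous_const).pow 2).mul (by fun_prop)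
    obtain ⟨x, hx⟩ : ∃ x, g 0 x ≠ m 0 := by
      by_contra! h
      have h1 := (h 0).trans (h (π / 2)).symm
      simp [g] at h1
    refine integral_pos_of_integrable_nonneg_nonzero (x := x) hcont (iV 0) hn ?_
    have := sub_ne_zero.2 hx
    positivity
  have hbdd : BddAbove (Set.range (deriv (deriv v))) := by
    refine ⟨(∫ x, cos ((((0 : ℕ) : ℝ) + 1)⁻¹ * x) ^ 2 * exp (-v x)) /
      ∫ x, (g 0 x - m 0) ^ 2 * exp (-v x), ?_⟩
    rintro _ ⟨t, rfl⟩
    exact (le_div_iff₀ hvar).2 (poincare 0 t)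
  let L : ℝ := max (⨆ t, deriv (deriv v) t) 0
  have hL0 : 0 ≤ L := le_max_right _ _
  have hL : ∀ t, deriv (deriv v) t ≤ L := fun t => (le_ciSup hbdd t).trans (le_max_left _ _)
  have hLP : ∀ k, L * ∫ x, (g k x - m k) ^ 2 * exp (-v x) ≤
      ∫ x, cos (((k : ℝ) + 1)⁻¹ * x) ^ 2 * exp (-v x) := fun k => by
    have hV : 0 ≤ ∫ x, (g k x - m k) ^ 2 * exp (-v x) :=
      integral_nonneg fun x => by positivity
    have hI : 0 ≤ ∫ x, cos (((k : ℝ) + 1)⁻¹ * x) ^ 2 * exp (-v x) :=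
      integral_nonneg fun x => by positivity
    rcases hV.eq_or_lt with h | h
    · rw [← h, mul_zero]; exact hI
    · rw [← le_div_iff₀ h]
      exact max_le (ciSup_le fun t => (le_div_iff₀ h).2 (poincare k t)) (by positivity)
  refine ⟨L, fun x₀ => ?_⟩
  by_contra hne
  obtain ⟨χ, hχ, hc, hχ0, hχ1, hχone⟩ := exists_smooth_cutoff ℝ
  let θ : ℝ → ℝ := fun x => χ (x - x₀)
  have hθ : Continuous θ := hχ.continuous.comp (by fun_prop)
  have hθc : HasCompactSupport θ := hc.comp_homeomorph (Homeomorph.subRight x₀)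
  have hpos : 0 < ∫ x, θ x * (L - deriv (deriv v) x) * exp (-v x) := by
    refine Continuous.integral_pos_of_hasCompactSupport_nonneg_nonzero (x := x₀) (by fun_prop)
      hθc.mul_right.mul_right (fun x => ?_) ?_
    · have h1 : 0 ≤ L - deriv (deriv v) x := sub_nonneg.2 (hL x)
      have h2 : 0 ≤ θ x := hχ0 _
      dsimp only [Pi.zero_apply]
      positivity
    · have h1 : θ x₀ = 1 := hχone _ (by simp)
      rw [h1, one_mul]
      exact mul_ne_zero (sub_ne_zero.2 (Ne.symm hne)) (exp_pos _).ne'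
  have hle : ∀ k : ℕ, ∫ x, θ x * (L - deriv (deriv v) x) * exp (-v x) ≤
      L * ∫ x, (1 - cos (((k : ℝ) + 1)⁻¹ * x)) ^ 2 * exp (-v x) := fun k => by
    have h1 := integral_cutoff_deficit_le hv hprob hL (h := fun x => L * (g k x - m k))
      (h' := fun x => L * cos (((k : ℝ) + 1)⁻¹ * x)) (B := L * ((k : ℝ) + 1 + |m k|)) (B' := L * 1)
      (fun x => ((hgd k x).sub_const _).const_mul L) (by fun_prop)
      (fun x => by
        rw [abs_mul, abs_of_nonneg hL0]
        exact mul_le_mul_of_nonneg_left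
          ((abs_sub _ _).trans (add_le_add_left (hgB k x) _)) hL0)
      (fun x => by
        rw [abs_mul, abs_of_nonneg hL0]
        exact mul_le_mul_of_nonneg_left (abs_cos_le_one _) hL0)
      hθ hθc (fun x => hχ1 _)
    have e1 : ∀ x, (L + (L * (g k x - m k)) ^ 2 - 2 * (L * cos (((k : ℝ) + 1)⁻¹ * x))) *
        exp (-v x) = L * exp (-v x) + L ^ 2 * ((g k x - m k) ^ 2 * exp (-v x)) -
          2 * L * (cos (((k : ℝ) + 1)⁻¹ * x) * exp (-v x)) := fun x => by ring
    have e2 : ∀ x, (1 - cos (((k : ℝ) + 1)⁻¹ * x)) ^ 2 * exp (-v x) = exp (-v x) +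
        cos (((k : ℝ) + 1)⁻¹ * x) ^ 2 * exp (-v x) -
          2 * (cos (((k : ℝ) + 1)⁻¹ * x) * exp (-v x)) := fun x => by ring
    simp_rw [e1] at h1
    simp_rw [e2]
    rw [integral_sub ((hρ.const_mul _).fun_add ((iV k).const_mul _)) ((iC k).const_mul _),
      integral_add (hρ.const_mul _) ((iV k).const_mul _), integral_const_mul, integral_const_mul,
      integral_const_mul, hprob] at h1
    rw [integral_sub (hρ.fun_add (iC2 k)) ((iC k).const_mul _), integral_add hρ (iC2 k),
      integral_const_mul, hprob]
    have h2 := mul_le_mul_of_nonneg_left (hLP k) hL0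
    linarith
  have hlim : Tendsto (fun k : ℕ => L * ∫ x, (1 - cos (((k : ℝ) + 1)⁻¹ * x)) ^ 2 * exp (-v x))
      atTop (𝓝 (L * ∫ x, 0 * exp (-v x))) := by
    refine (tendsto_integral_mul_of_bounded hρ (fun k => by fun_prop) (C := 2 ^ 2)
      (fun k x => ?_) fun x => ?_).const_mul L
    · rw [abs_pow]
      refine pow_le_pow_left₀ (abs_nonneg _) (abs_le.2 ⟨?_, ?_⟩) 2 <;>
        linarith [neg_one_le_cos (((k : ℝ) + 1)⁻¹ * x), cos_le_one (((k : ℝ) + 1)⁻¹ * x)]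
    · have h1 : Tendsto (fun k : ℕ => ((k : ℝ) + 1)⁻¹ * x) atTop (𝓝 0) := by
        simpa [one_div] using
          (tendsto_one_div_add_atTop_nhds_zero_nat (𝕜 := ℝ)).mul_const x
      simpa using (((continuous_cos.tendsto 0).comp h1).const_sub 1).pow 2
  have := ge_of_tendsto' hlim hle
  simp at this
  linarith
end

section
/- Let Λ be the logistic measure on ℝ with density f(x) = e^x/(1+e^x)². Then for every t ∈ [0,1] the isoperimetric function of Λ satisfies I_Λ(t) = t(1−t); in particular, half-lines (−∞, F^{−1}(t)], where F(x) = e^x/(1+e^x) is the distribution function of Λ, are isoperimetric sets. -/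
open MeasureTheory Real
open scoped ENNReal

/-- The logistic density `f(x) = eˣ/(1+eˣ)²`. -/
noncomputable def logisticDensity (x : ℝ) : ℝ := Real.exp x / (1 + Real.exp x) ^ 2

/-- The logistic measure `dΛ(x) = f(x) dx` on `ℝ`. -/
noncomputable def logisticMeasure : Measure ℝ :=
  volume.withDensity fun x => ENNReal.ofReal (logisticDensity x)

/-- The boundary measure (Minkowski content) of a set `A`:
`τ⁺(∂A) = lim_{h→0⁺} (τ(A_h) - τ(A))/h` where `A_h = {x : dist(x,A) ≤ h}`. -/
noncomputable def boundaryMeasure {E : Type*} [MeasurableSpace E] [PseudoEMetricSpace E]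
    (τ : Measure E) (A : Set E) : ℝ≥0∞ :=
  Filter.liminf (fun h : ℝ => (τ (Metric.cthickening h A) - τ A) / ENNReal.ofReal h)
    (nhdsWithin 0 (Set.Ioi 0))

/-- The isoperimetric function `I_τ(y) = inf { τ⁺(∂A) : A Borel, τ(A) = y }`. -/
noncomputable def isopFun {E : Type*} [MeasurableSpace E] [PseudoEMetricSpace E]
    (τ : Measure E) (y : ℝ) : ℝ≥0∞ :=
  sInf {b | ∃ A : Set E, MeasurableSet A ∧ (τ A).toReal = y ∧ b = boundaryMeasure τ A}

open Set Filter Topology Metric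

lemma logisticDensity_eq_sigmoid (x : ℝ) :
    logisticDensity x = sigmoid x * (1 - sigmoid x) := by
  have := Real.exp_pos x
  rw [logisticDensity, sigmoid_def, Real.exp_neg]
  field_simp
  ring

lemma logisticDensity_nonneg (x : ℝ) : 0 ≤ logisticDensity x := by
  unfold logisticDensity
  positivity

lemma logisticMeasure_apply {s : Set ℝ} (hs : MeasurableSet s) :
    logisticMeasure s = ∫⁻ x in s, ENNReal.ofReal (logisticDensity x) :=
  withDensity_apply _ hs

instance : NullSingletonClass logisticMeasure where
  measure_singleton x := withDensity_absolutelyContinuous _ _ (measure_singleton x)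

lemma logisticMeasure_Ici (x : ℝ) :
    logisticMeasure (Ici x) = ENNReal.ofReal (1 - sigmoid x) := by
  have hderiv : ∀ y ∈ Ici x, HasDerivAt sigmoid (logisticDensity y) y := fun y _ => by
    rw [logisticDensity_eq_sigmoid]
    exact hasDerivAt_sigmoid y
  have hpos : ∀ y ∈ Ioi x, 0 ≤ logisticDensity y := fun y _ => logisticDensity_nonneg y
  rw [← measure_congr (Ioi_ae_eq_Ici (μ := logisticMeasure)),
    logisticMeasure_apply measurableSet_Ioi, ← ofReal_integral_eq_lintegral_ofReal
      (integrableOn_Ioi_deriv_of_nonneg' hderiv hpos tendsto_sigmoid_atTop)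
      (Eventually.of_forall logisticDensity_nonneg),
    integral_Ioi_of_hasDerivAt_of_nonneg' hderiv hpos tendsto_sigmoid_atTop]

instance : IsProbabilityMeasure logisticMeasure where
  measure_univ := by
    refine tendsto_nhds_unique (tendsto_measure_Ici_atBot logisticMeasure) ?_
    simp_rw [logisticMeasure_Ici]
    have := ENNReal.tendsto_ofReal (tendsto_sigmoid_atBot.const_sub 1)
    simpa using this

lemma logisticMeasure_Iic (x : ℝ) :
    logisticMeasure (Iic x) = ENNReal.ofReal (sigmoid x) := by
  rw [← measure_congr (Iio_ae_eq_Iic (μ := logisticMeasure)), ← compl_Ici,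
    prob_compl_eq_one_sub measurableSet_Ici, logisticMeasure_Ici, ← ENNReal.ofReal_one,
    ← ENNReal.ofReal_sub _ (sub_nonneg.2 (sigmoid_le_one x))]
  simp

/-- A segment joining a point of `A` to a point outside the closed `h`-thickening of `A`
spends length at least `h` in the collar around `A`. -/
lemma ofReal_le_volume_collar_inter_uIcc {A : Set ℝ} {h x y : ℝ} (hx : x ∈ A)
    (hy : y ∉ cthickening h A) :
    ENNReal.ofReal h ≤ volume ((cthickening h A \ A) ∩ uIcc x y) := by
  rcases le_or_gt h 0 with h0 | h0
  · simp [ENNReal.ofReal_of_nonpos h0]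
  have hmem : ∀ z, z ∈ cthickening h A ↔ infDist z A ≤ h := fun z => by
    rw [mem_cthickening_iff, infDist, ENNReal.le_ofReal_iff_toReal_le
      (infEDist_ne_top ⟨x, hx⟩) h0.le]
  have hyd : h < infDist y A := by simpa [hmem] using hy
  have hsub : Ioc 0 h ⊆ (infDist · A) '' ((cthickening h A \ A) ∩ uIcc x y) := by
    intro s hs
    obtain ⟨z, hz, rfl⟩ := intermediate_value_uIcc (f := (infDist · A))
      (continuous_infDist_pt A).continuousOn
      (show s ∈ uIcc (infDist x A) (infDist y A) by
        rw [infDist_zero_of_mem hx]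
        exact mem_uIcc_of_le hs.1.le (hs.2.trans hyd.le))
    exact ⟨z, ⟨⟨(hmem z).2 hs.2, fun hzA => hs.1.ne' (infDist_zero_of_mem hzA)⟩, hz⟩, rfl⟩
  calc ENNReal.ofReal h = volume (Ioc 0 h) := by simp
    _ ≤ volume ((infDist · A) '' ((cthickening h A \ A) ∩ uIcc x y)) := measure_mono hsub
    _ ≤ volume ((cthickening h A \ A) ∩ uIcc x y) := by
      simpa [hausdorffMeasure_real] using
        (lipschitz_infDist_pt A).hausdorffMeasure_image_le zero_le_one
          ((cthickening h A \ A) ∩ uIcc x y)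

/-- Pairs in `A × C`, with `A` and `C` disjoint, that are separated by `z` have mass at most
the logistic density at `z`. -/
lemma prod_restrict_separated_le {A C : Set ℝ} (hA : MeasurableSet A) (hC : MeasurableSet C)
    (hAC : Disjoint A C) (z : ℝ) :
    ((logisticMeasure.prod logisticMeasure).restrict (A ×ˢ C)) {p | z ∈ uIcc p.1 p.2} ≤
      ENNReal.ofReal (logisticDensity z) := by
  have hsub : {p : ℝ × ℝ | z ∈ uIcc p.1 p.2} ∩ A ×ˢ C ⊆
      (A ∩ Iic z) ×ˢ (C ∩ Ici z) ∪ (A ∩ Ici z) ×ˢ (C ∩ Iic z) := by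
    rintro ⟨x, y⟩ ⟨hz, hx, hy⟩
    rcases mem_uIcc.1 hz with hz | hz
    · exact Or.inl ⟨⟨hx, hz.1⟩, hy, hz.2⟩
    · exact Or.inr ⟨⟨hx, hz.2⟩, hy, hz.1⟩
  have hle : ∀ T : Set ℝ, MeasurableSet T →
      logisticMeasure (A ∩ T) + logisticMeasure (C ∩ T) ≤ logisticMeasure T := fun T hT => by
    rw [← measure_union (hAC.mono inter_subset_left inter_subset_left) (hC.inter hT)]
    exact measure_mono (union_subset inter_subset_right inter_subset_right)
  rw [Measure.restrict_apply' (hA.prod hC)]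
  calc _ ≤ logisticMeasure (A ∩ Iic z) * logisticMeasure (C ∩ Ici z) +
        logisticMeasure (A ∩ Ici z) * logisticMeasure (C ∩ Iic z) := by
        refine (measure_mono hsub).trans ((measure_union_le _ _).trans_eq ?_)
        rw [Measure.prod_prod, Measure.prod_prod]
    _ ≤ (logisticMeasure (A ∩ Iic z) + logisticMeasure (C ∩ Iic z)) *
        (logisticMeasure (A ∩ Ici z) + logisticMeasure (C ∩ Ici z)) := by
        rw [add_mul, mul_add, mul_add, mul_comm (logisticMeasure (C ∩ Iic z))
          (logisticMeasure (A ∩ Ici z)), add_assoc]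
        exact le_add_left (add_le_add_right le_self_add _)
    _ ≤ logisticMeasure (Iic z) * logisticMeasure (Ici z) :=
        mul_le_mul' (hle _ measurableSet_Iic) (hle _ measurableSet_Ici)
    _ = ENNReal.ofReal (logisticDensity z) := by
        rw [logisticMeasure_Iic, logisticMeasure_Ici, ← ENNReal.ofReal_mul (sigmoid_nonneg z),
          logisticDensity_eq_sigmoid]

/-- The isoperimetric inequality at scale `h`. -/
lemma mul_logisticMeasure_compl_le_collar {A : Set ℝ} (hA : MeasurableSet A) (h : ℝ) :
    ENNReal.ofReal h * (logisticMeasure A * logisticMeasure (cthickening h A)ᶜ) ≤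
      logisticMeasure (cthickening h A \ A) := by
  have hB : MeasurableSet (cthickening h A) := isClosed_cthickening.measurableSet
  set B := cthickening h A
  set S : Set ((ℝ × ℝ) × ℝ) := {q | q.2 ∈ uIcc q.1.1 q.1.2} with hS
  have hSm : MeasurableSet S := by
    have hmin : Continuous fun q : (ℝ × ℝ) × ℝ => q.1.1 ⊓ q.1.2 := by fun_prop
    have hmax : Continuous fun q : (ℝ × ℝ) × ℝ => q.1.1 ⊔ q.1.2 := by fun_prop
    exact ((isClosed_le hmin continuous_snd).inter
      (isClosed_le continuous_snd hmax)).measurableSet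
  set ν := (logisticMeasure.prod logisticMeasure).restrict (A ×ˢ Bᶜ) with hν
  calc ENNReal.ofReal h * (logisticMeasure A * logisticMeasure Bᶜ)
      = ∫⁻ _, ENNReal.ofReal h ∂ν := by
        simp [hν, Measure.prod_prod]
    _ ≤ ∫⁻ p, (∫⁻ z in B \ A, S.indicator 1 (p, z)) ∂ν := by
        refine setLIntegral_mono' (hA.prod hB.compl) fun p hp => ?_
        refine (ofReal_le_volume_collar_inter_uIcc hp.1 hp.2).trans_eq ?_
        change _ = ∫⁻ z in B \ A, (uIcc p.1 p.2).indicator 1 z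
        rw [lintegral_indicator_one measurableSet_uIcc,
          Measure.restrict_apply measurableSet_uIcc, inter_comm]
    _ = ∫⁻ z in B \ A, ∫⁻ p, S.indicator 1 (p, z) ∂ν :=
        lintegral_lintegral_swap (measurable_one.indicator hSm).aemeasurable
    _ ≤ ∫⁻ z in B \ A, ENNReal.ofReal (logisticDensity z) := by
        refine lintegral_mono fun z => ?_
        have hm : MeasurableSet {p : ℝ × ℝ | z ∈ uIcc p.1 p.2} :=
          hSm.preimage measurable_prodMk_right
        change ∫⁻ p, {p : ℝ × ℝ | z ∈ uIcc p.1 p.2}.indicator 1 p ∂ν ≤ _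
        rw [lintegral_indicator_one hm]
        exact prod_restrict_separated_le hA hB.compl
          (disjoint_compl_right.mono_left (self_subset_cthickening A)) z
    _ = logisticMeasure (B \ A) := (logisticMeasure_apply (hB.diff hA)).symm

/-- The isoperimetric inequality for the logistic measure. -/
lemma ofReal_mul_one_sub_le_boundaryMeasure {A : Set ℝ} (hA : MeasurableSet A) :
    ENNReal.ofReal (logisticMeasure.real A * (1 - logisticMeasure.real A)) ≤
      boundaryMeasure logisticMeasure A := by
  set a := logisticMeasure.real A with ha
  have ha0 : 0 ≤ a := measureReal_nonneg
  have hlim : Tendsto (fun h : ℝ => ENNReal.ofReal (a * (1 - a) / (1 + h * a))) (𝓝[>] 0)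
      (𝓝 (ENNReal.ofReal (a * (1 - a)))) := by
    refine ENNReal.tendsto_ofReal (tendsto_nhdsWithin_of_tendsto_nhds ?_)
    have : ContinuousAt (fun h : ℝ => a * (1 - a) / (1 + h * a)) 0 :=
      ContinuousAt.div (by fun_prop) (by fun_prop) (by simp)
    simpa [ContinuousAt] using this
  rw [← hlim.liminf_eq]
  refine liminf_le_liminf (eventually_nhdsWithin_of_forall fun h hh => ?_)
  have h0 : (0 : ℝ) < h := hh
  have hB : MeasurableSet (cthickening h A) := isClosed_cthickening.measurableSet
  have key := ENNReal.toReal_mono (measure_ne_top _ _) (mul_logisticMeasure_compl_le_collar hA h)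
  rw [ENNReal.toReal_mul, ENNReal.toReal_mul, ENNReal.toReal_ofReal h0.le] at key
  simp only [← measureReal_def] at key
  rw [probReal_compl_eq_one_sub hB, measureReal_sdiff (self_subset_cthickening A) hA,
    ← ha] at key
  rw [← ofReal_measureReal, ← ofReal_measureReal (s := A), ← ha, ← ENNReal.ofReal_sub _ ha0,
    ← ENNReal.ofReal_div_of_pos h0]
  refine ENNReal.ofReal_le_ofReal ?_
  rw [div_le_div_iff₀ (by positivity) h0]
  linarith

lemma boundaryMeasure_logisticMeasure_Iic_le (x : ℝ) :
    boundaryMeasure logisticMeasure (Iic x) ≤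
      ENNReal.ofReal (sigmoid x * (1 - sigmoid x)) := by
  have hlim : Tendsto (fun h : ℝ => ENNReal.ofReal ((sigmoid (x + h) - sigmoid x) / h)) (𝓝[>] 0)
      (𝓝 (ENNReal.ofReal (sigmoid x * (1 - sigmoid x)))) := by
    refine ENNReal.tendsto_ofReal ?_
    have := (hasDerivAt_sigmoid x).tendsto_slope_zero_right
    simpa [div_eq_inv_mul] using this
  rw [← hlim.liminf_eq]
  refine liminf_le_liminf (eventually_nhdsWithin_of_forall fun h hh => ?_)
  have h0 : (0 : ℝ) < h := hh
  have hsub : cthickening h (Iic x) ⊆ Iic (x + h) := by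
    rw [isClosed_Iic.cthickening_eq_biUnion_closedBall h0.le]
    simp only [iUnion_subset_iff]
    intro y hy z hz
    have := (abs_le.1 (Real.dist_eq z y ▸ mem_closedBall.1 hz)).2
    have := mem_Iic.1 hy
    exact mem_Iic.2 (by linarith)
  rw [ENNReal.ofReal_div_of_pos h0, ENNReal.ofReal_sub _ (sigmoid_nonneg x),
    ← logisticMeasure_Iic, ← logisticMeasure_Iic]
  gcongr

lemma isopFun_logisticMeasure_le {A : Set ℝ} {t : ℝ} (hA : MeasurableSet A)
    (ht : (logisticMeasure A).toReal = t) :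
    isopFun logisticMeasure t ≤ boundaryMeasure logisticMeasure A :=
  sInf_le ⟨A, hA, ht, rfl⟩

lemma isopFun_logisticMeasure {t : ℝ} (ht : t ∈ Icc (0 : ℝ) 1) :
    isopFun logisticMeasure t = ENNReal.ofReal (t * (1 - t)) := by
  apply le_antisymm
  · rcases ht.1.eq_or_lt with rfl | h0
    · refine (isopFun_logisticMeasure_le MeasurableSet.empty (by simp)).trans ?_
      simp [boundaryMeasure]
    rcases ht.2.eq_or_lt with rfl | h1
    · refine (isopFun_logisticMeasure_le MeasurableSet.univ (by simp)).trans ?_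
      simp [boundaryMeasure, (subset_univ _).antisymm (self_subset_cthickening univ)]
    obtain ⟨x, rfl⟩ : t ∈ range sigmoid := range_sigmoid ▸ ⟨h0, h1⟩
    refine (isopFun_logisticMeasure_le measurableSet_Iic ?_).trans
      (boundaryMeasure_logisticMeasure_Iic_le x)
    rw [logisticMeasure_Iic, ENNReal.toReal_ofReal h0.le]
  · refine le_sInf ?_
    rintro _ ⟨A, hA, rfl, rfl⟩
    exact ofReal_mul_one_sub_le_boundaryMeasure hA

/-- The isoperimetric function of the logistic measure is `I_Λ(t) = t(1-t)` for all
`t ∈ [0,1]`; in particular, half-lines `(-∞, x]` are isoperimetric sets. -/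
theorem logistic_isoperimetric_function :
    (∀ t ∈ Set.Icc (0 : ℝ) 1, isopFun logisticMeasure t = ENNReal.ofReal (t * (1 - t))) ∧
    ∀ x : ℝ, boundaryMeasure logisticMeasure (Set.Iic x) =
      isopFun logisticMeasure ((logisticMeasure (Set.Iic x)).toReal) := by
  refine ⟨fun t ht => isopFun_logisticMeasure ht, fun x => ?_⟩
  refine le_antisymm ?_ (isopFun_logisticMeasure_le measurableSet_Iic rfl)
  rw [logisticMeasure_Iic, ENNReal.toReal_ofReal (sigmoid_nonneg x),
    isopFun_logisticMeasure ⟨sigmoid_nonneg x, sigmoid_le_one x⟩]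
  exact boundaryMeasure_logisticMeasure_Iic_le x
end
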